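/- Let P be a real m×m matrix. Then the determinant of the matrix power series ∑_{k=0}^∞ ((−1)^k/(k+1)!) P^k satisfies, as an identity of complex numbers: det(∑_{k=0}^∞ ((−1)^k/(k+1)!) P^k) = ∏_{λ} (1 − e^{−λ})/λ, where the product runs over the multiset of nonzero complex roots (counted with algebraic multiplicity) of the characteristic polynomial of P. -/

import Mathlib

open Matrix Polynomial

/-- The determinant of `A - r` is the product of `l - r` over the eigenvalues `l` of `A`. -/
theorem Matrix.det_sub_algebraMap_eq_prod_roots_charpoly {n K : Type*} [Fintype n] [DecidableEq n]
    [Field K] [IsAlgClosed K] (A : Matrix n n K) (r : K) :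
    (A - algebraMap K (Matrix n n K) r).det = (A.charpoly.roots.map (fun l => l - r)).prod := by
  have hs : A.charpoly.Splits := IsAlgClosed.splits _
  have hcard : A.charpoly.roots.card = Fintype.card n := by
    rw [← hs.natDegree_eq_card_roots, A.charpoly_natDegree_eq_dim]
  have heval : A.charpoly.eval r = (A.charpoly.roots.map (fun l => r - l)).prod := by
    conv_lhs => rw [hs.eq_prod_roots_of_monic A.charpoly_monic]
    simp [eval_multiset_prod, Multiset.map_map]
  have hneg : A - algebraMap K (Matrix n n K) r = -(Matrix.scalar n r - A) := by
    rw [neg_sub]; rfl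
  rw [hneg, Matrix.det_neg, ← Matrix.eval_charpoly, heval, ← hcard]
  have h : (A.charpoly.roots.map (fun l => l - r)) =
      (A.charpoly.roots.map (fun l => r - l)).map Neg.neg := by
    simp [Multiset.map_map]
  rw [h, Multiset.prod_map_neg, Multiset.card_map]

/-- The determinant of a polynomial in `A` is the product of its values at the eigenvalues. -/
theorem Matrix.det_aeval_eq_prod_roots_charpoly {n K : Type*} [Fintype n] [DecidableEq n]
    [Field K] [IsAlgClosed K] (A : Matrix n n K) (q : K[X]) :
    (aeval A q).det = (A.charpoly.roots.map (fun l => q.eval l)).prod := by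
  have hcard : A.charpoly.roots.card = Fintype.card n := by
    rw [← (IsAlgClosed.splits A.charpoly).natDegree_eq_card_roots, A.charpoly_natDegree_eq_dim]
  have hprod (s : Multiset K) : (aeval A (s.map (fun r => X - C r)).prod).det =
      (A.charpoly.roots.map (fun l => (s.map (fun r => X - C r)).prod.eval l)).prod := by
    induction s using Multiset.induction_on with
    | empty => simp
    | cons r s ih =>
      simp only [Multiset.map_cons, Multiset.prod_cons, map_mul, Matrix.det_mul, ih, eval_mul,
        Multiset.prod_map_mul]
      congr 1
      simpa using A.det_sub_algebraMap_eq_prod_roots_charpoly r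
  rw [(IsAlgClosed.splits q).eq_prod_roots]
  simp only [map_mul, Matrix.det_mul, eval_mul, Multiset.prod_map_mul, hprod]
  simp [Matrix.algebraMap_eq_diagonal, hcard]

theorem Matrix.summable_neg_one_pow_div_factorial_smul_pow {n : Type*} [Fintype n] [DecidableEq n]
    (P : Matrix n n ℝ) :
    Summable (fun k : ℕ => ((-1 : ℝ) ^ k / (Nat.factorial (k + 1) : ℝ)) • P ^ k) := by
  let _ : NormedRing (Matrix n n ℝ) := Matrix.linftyOpNormedRing
  let _ : NormedAlgebra ℝ (Matrix n n ℝ) := Matrix.linftyOpNormedAlgebra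
  refine Summable.of_norm_bounded (NormedSpace.norm_expSeries_summable' (𝕂 := ℝ) P) fun k => ?_
  rw [norm_smul, norm_smul]
  gcongr
  simp only [norm_div, norm_pow, norm_neg, norm_one, one_pow, norm_inv, RCLike.norm_natCast,
    one_div]
  gcongr
  exact k.le_succ

theorem Complex.hasSum_neg_one_pow_div_factorial_mul_pow {z : ℂ} (hz : z ≠ 0) :
    HasSum (fun k : ℕ => ((-1 : ℂ) ^ k / (Nat.factorial (k + 1) : ℂ)) * z ^ k)
      ((1 - Complex.exp (-z)) / z) := by
  have h : HasSum (fun k : ℕ => (-z) ^ k / (Nat.factorial k : ℂ)) (Complex.exp (-z)) := by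
    rw [Complex.exp_eq_exp_ℂ]
    exact NormedSpace.expSeries_div_hasSum_exp (-z)
  have h1 := ((hasSum_nat_add_iff' 1).mpr h).mul_left (-z⁻¹)
  have hterm : (fun k : ℕ => ((-1 : ℂ) ^ k / (Nat.factorial (k + 1) : ℂ)) * z ^ k) =
      fun k : ℕ => -z⁻¹ * ((-z) ^ (k + 1) / (Nat.factorial (k + 1) : ℂ)) := by
    funext k
    rw [neg_pow z, pow_succ, pow_succ z]
    field_simp
  have hvalue : (1 - Complex.exp (-z)) / z =
      -z⁻¹ * (Complex.exp (-z) - ∑ k ∈ Finset.range 1, (-z) ^ k / (Nat.factorial k : ℂ)) := by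
    simp only [Finset.sum_range_one, pow_zero, Nat.factorial_zero, Nat.cast_one, div_one]
    ring
  rw [hterm, hvalue]
  exact h1

/-- A product over the elements satisfying `p`, as a product over all elements. -/
theorem Multiset.prod_map_filter_eq_prod_map_ite {ι M : Type*} [CommMonoid M] (p : ι → Prop)
    [DecidablePred p] (f : ι → M) (s : Multiset ι) :
    ((s.filter p).map f).prod = (s.map (fun i => if p i then f i else 1)).prod := by
  induction s using Multiset.induction_on with
  | empty => simp
  | cons a s ih => by_cases h : p a <;> simp [h, ih]

/-- For a real `m × m` matrix `P`, the determinant of `∑_{k=0}^∞ ((−1)^k/(k+1)!) P^k`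
equals (as a complex number) the product of `(1 − e^{−λ})/λ` over the multiset of nonzero
complex roots `λ` (with algebraic multiplicity) of the characteristic polynomial of `P`. -/
theorem det_series_eq_prod_eigenvalues (m : ℕ) (P : Matrix (Fin m) (Fin m) ℝ) :
    ((∑' k : ℕ, ((-1 : ℝ) ^ k / (Nat.factorial (k + 1) : ℝ)) • P ^ k).det : ℂ) =
      ((((P.charpoly.map (algebraMap ℝ ℂ)).roots).filter (fun lam => lam ≠ 0)).map
        (fun lam => (1 - Complex.exp (-lam)) / lam)).prod := by
  let q (N : ℕ) : ℂ[X] :=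
    ∑ k ∈ Finset.range N, C ((-1 : ℂ) ^ k / (Nat.factorial (k + 1) : ℂ)) * X ^ k
  let g (z : ℂ) : ℂ := if z ≠ 0 then (1 - Complex.exp (-z)) / z else 1
  have hg (z : ℂ) : Filter.Tendsto (fun N => (q N).eval z) Filter.atTop (nhds (g z)) := by
    have h : HasSum (fun k : ℕ => ((-1 : ℂ) ^ k / (Nat.factorial (k + 1) : ℂ)) * z ^ k) (g z) := by
      by_cases hz : z = 0
      · subst hz
        convert hasSum_single (0 : ℕ) _ using 1
        · simp [g]
        · intro k hk
          simp [hk]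
      · simpa [g, hz] using Complex.hasSum_neg_one_pow_div_factorial_mul_pow hz
    simpa [q, eval_finsetSum] using h.tendsto_sum_nat
  have hdet (N : ℕ) :
      ((∑ k ∈ Finset.range N, ((-1 : ℝ) ^ k / (Nat.factorial (k + 1) : ℝ)) • P ^ k).det : ℂ) =
        (((P.charpoly.map (algebraMap ℝ ℂ)).roots).map (fun l => (q N).eval l)).prod := by
    rw [← Matrix.charpoly_map, ← Matrix.det_aeval_eq_prod_roots_charpoly]
    rw [← Complex.coe_algebraMap, RingHom.map_det]
    congr 1
    simp only [map_sum, q, map_mul, aeval_C, map_pow, aeval_X]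
    refine Finset.sum_congr rfl fun k _ => ?_
    rw [← Algebra.smul_def, ← RingHom.mapMatrix_apply, ← map_pow]
    ext i j
    simp
  have hleft := (Complex.continuous_ofReal.comp (continuous_id.matrix_det)).continuousAt.tendsto.comp
    P.summable_neg_one_pow_div_factorial_smul_pow.hasSum.tendsto_sum_nat
  have hright := tendsto_multiset_prod (P.charpoly.map (algebraMap ℝ ℂ)).roots
    (f := fun z N => (q N).eval z) (fun z _ => hg z)
  have h := tendsto_nhds_unique hleft (hright.congr fun N => (hdet N).symm)
  refine h.trans ?_
  exact (Multiset.prod_map_filter_eq_prod_map_ite _ _ _).symm
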